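/- For every natural number n ≥ 2, G(0, 2, n) = 1 if and only if n = 2, or n ≥ 5 and n ≡ 1 (mod 4). -/

import Mathlib

namespace SharingNim

/-- The moves of three-pile Sharing Nim: take `k ≥ 1` tokens from one pile and add them to
another pile, provided the receiving pile has at most as many tokens as the source pile
after the move (i.e. `2 * k` is at most the difference of the two piles). -/
def moves : ℕ × ℕ × ℕ → Finset (ℕ × ℕ × ℕ)
  | (a, b, c) =>
    ((Finset.Icc 1 ((b - a) / 2)).image fun k => (a + k, b - k, c)) ∪
    ((Finset.Icc 1 ((a - b) / 2)).image fun k => (a - k, b + k, c)) ∪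
    ((Finset.Icc 1 ((c - a) / 2)).image fun k => (a + k, b, c - k)) ∪
    ((Finset.Icc 1 ((a - c) / 2)).image fun k => (a - k, b, c + k)) ∪
    ((Finset.Icc 1 ((c - b) / 2)).image fun k => (a, b + k, c - k)) ∪
    ((Finset.Icc 1 ((b - c) / 2)).image fun k => (a, b - k, c + k))

/-- The sum of squares of the pile sizes, a measure that strictly decreases along
every move. -/
def measure3 (p : ℕ × ℕ × ℕ) : ℕ := p.1 ^ 2 + p.2.1 ^ 2 + p.2.2 ^ 2

theorem sq_move_lt {x y k : ℕ} (hk : 1 ≤ k) (h : k ≤ (y - x) / 2) :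
    (x + k) ^ 2 + (y - k) ^ 2 < x ^ 2 + y ^ 2 := by
  have h1 : x + 2 * k ≤ y := by omega
  have h2 : k ≤ y := by omega
  zify [h2]
  nlinarith

theorem measure3_lt_of_mem_moves {q p : ℕ × ℕ × ℕ} (h : q ∈ moves p) :
    measure3 q < measure3 p := by
  obtain ⟨a, b, c⟩ := p
  simp only [moves, Finset.mem_union, Finset.mem_image, Finset.mem_Icc] at h
  rcases h with ((((⟨k, ⟨hk1, hk2⟩, rfl⟩ | ⟨k, ⟨hk1, hk2⟩, rfl⟩) | ⟨k, ⟨hk1, hk2⟩, rfl⟩) |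
      ⟨k, ⟨hk1, hk2⟩, rfl⟩) | ⟨k, ⟨hk1, hk2⟩, rfl⟩) | ⟨k, ⟨hk1, hk2⟩, rfl⟩ <;>
    simp only [measure3] <;>
    [linarith [sq_move_lt (x := a) (y := b) hk1 hk2];
     linarith [sq_move_lt (x := b) (y := a) hk1 hk2];
     linarith [sq_move_lt (x := a) (y := c) hk1 hk2];
     linarith [sq_move_lt (x := c) (y := a) hk1 hk2];
     linarith [sq_move_lt (x := b) (y := c) hk1 hk2];
     linarith [sq_move_lt (x := c) (y := b) hk1 hk2]]

/-- The minimum excludant of a finite set of naturals. -/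
noncomputable def mex (s : Finset ℕ) : ℕ := sInf {n : ℕ | n ∉ s}

/-- The Sprague–Grundy value of a position of three-pile Sharing Nim: the minimum
excludant of the Sprague–Grundy values of the positions reachable in one move. -/
noncomputable def G (p : ℕ × ℕ × ℕ) : ℕ :=
  mex ((moves p).attach.image fun q => G q.1)
termination_by measure3 p
decreasing_by exact measure3_lt_of_mem_moves q.2

/-- `d = 0` or the 2-adic valuation of `d` is even. -/
def E (d : ℕ) : Prop := d = 0 ∨ Even (padicValNat 2 d)

theorem E_zero : E 0 := Or.inl rfl

theorem E_two_mul {d : ℕ} (hd : 0 < d) : E (2 * d) ↔ ¬ E d := by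
  have h : padicValNat 2 (2 * d) = 1 + padicValNat 2 d := by
    rw [padicValNat.mul (by norm_num) (by omega)]
    simp
  have h1 : ¬ (2 * d = 0) := by omega
  have h2 : ¬ (d = 0) := by omega
  simp only [E, h1, h2, false_or, h]
  rw [Nat.even_add]
  simp

theorem E_odd {d : ℕ} (hd : d % 2 = 1) : E d := by
  right
  rw [padicValNat.eq_zero_of_not_dvd (by omega)]
  simp

theorem not_E_two {d : ℕ} (hd : d % 4 = 2) : ¬ E d := by
  obtain ⟨k, rfl⟩ : ∃ k, d = 2 * k := ⟨d / 2, by omega⟩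
  rw [E_two_mul (by omega), not_not]
  exact E_odd (by omega)

theorem E_four {d : ℕ} (hd : d % 8 = 4) : E d := by
  obtain ⟨k, rfl⟩ : ∃ k, d = 2 * k := ⟨d / 2, by omega⟩
  rw [E_two_mul (by omega)]
  exact not_E_two (by omega)

/-- Value zero, in terms of the two gaps. -/
def D0 (x y : ℕ) : Prop := (x = 0 ∧ E y) ∨ (y = 0 ∧ E x)

/-- Value one, in terms of the two gaps. -/
def D1 (x y : ℕ) : Prop :=
  (x = 0 ∧ y % 4 = 2) ∨ (y = 0 ∧ x % 4 = 2) ∨ (x = 1 ∧ y = 1) ∨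
    (x = 2 ∧ y % 4 = 3) ∨ (y = 2 ∧ x % 4 = 3)

/-- Lower gap of a triple. -/
def lo (p : ℕ × ℕ × ℕ) : ℕ :=
  p.1 + p.2.1 + p.2.2 - max (max p.1 p.2.1) p.2.2 - 2 * min (min p.1 p.2.1) p.2.2

/-- Upper gap of a triple. -/
def hi (p : ℕ × ℕ × ℕ) : ℕ :=
  2 * max (max p.1 p.2.1) p.2.2 + min (min p.1 p.2.1) p.2.2 - (p.1 + p.2.1 + p.2.2)

theorem lo_sorted {a b c : ℕ} (h : a ≤ b) (h' : b ≤ c) : lo (a, b, c) = b - a := by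
  simp only [lo]; omega

theorem hi_sorted {a b c : ℕ} (h : a ≤ b) (h' : b ≤ c) : hi (a, b, c) = c - b := by
  simp only [hi]; omega

def s1 (p : ℕ × ℕ × ℕ) : ℕ × ℕ × ℕ := (p.2.1, p.1, p.2.2)
def s2 (p : ℕ × ℕ × ℕ) : ℕ × ℕ × ℕ := (p.1, p.2.2, p.2.1)

theorem lo_s1 (p) : lo (s1 p) = lo p := by simp only [lo, s1]; omega
theorem lo_s2 (p) : lo (s2 p) = lo p := by simp only [lo, s2]; omega
theorem hi_s1 (p) : hi (s1 p) = hi p := by simp only [hi, s1]; omega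
theorem hi_s2 (p) : hi (s2 p) = hi p := by simp only [hi, s2]; omega

/-- Gap pair `(u, v)` is reachable from `p`. -/
def R (p : ℕ × ℕ × ℕ) (u v : ℕ) : Prop := ∃ q ∈ moves p, lo q = u ∧ hi q = v

theorem mem_moves_s1 {q p} (h : q ∈ moves p) : s1 q ∈ moves (s1 p) := by
  obtain ⟨a, b, c⟩ := p
  simp only [moves, s1, Finset.mem_union, Finset.mem_image] at h ⊢
  rcases h with ((((⟨k, hk, rfl⟩ | ⟨k, hk, rfl⟩) | ⟨k, hk, rfl⟩) |
      ⟨k, hk, rfl⟩) | ⟨k, hk, rfl⟩) | ⟨k, hk, rfl⟩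
  · exact Or.inl (Or.inl (Or.inl (Or.inl (Or.inr ⟨k, hk, rfl⟩))))
  · exact Or.inl (Or.inl (Or.inl (Or.inl (Or.inl ⟨k, hk, rfl⟩))))
  · exact Or.inl (Or.inr ⟨k, hk, rfl⟩)
  · exact Or.inr ⟨k, hk, rfl⟩
  · exact Or.inl (Or.inl (Or.inl (Or.inr ⟨k, hk, rfl⟩)))
  · exact Or.inl (Or.inl (Or.inr ⟨k, hk, rfl⟩))

theorem mem_moves_s2 {q p} (h : q ∈ moves p) : s2 q ∈ moves (s2 p) := by
  obtain ⟨a, b, c⟩ := p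
  simp only [moves, s2, Finset.mem_union, Finset.mem_image] at h ⊢
  rcases h with ((((⟨k, hk, rfl⟩ | ⟨k, hk, rfl⟩) | ⟨k, hk, rfl⟩) |
      ⟨k, hk, rfl⟩) | ⟨k, hk, rfl⟩) | ⟨k, hk, rfl⟩
  · exact Or.inl (Or.inl (Or.inl (Or.inr ⟨k, hk, rfl⟩)))
  · exact Or.inl (Or.inl (Or.inr ⟨k, hk, rfl⟩))
  · exact Or.inl (Or.inl (Or.inl (Or.inl (Or.inl ⟨k, hk, rfl⟩))))
  · exact Or.inl (Or.inl (Or.inl (Or.inl (Or.inr ⟨k, hk, rfl⟩))))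
  · exact Or.inr ⟨k, hk, rfl⟩
  · exact Or.inl (Or.inr ⟨k, hk, rfl⟩)

theorem R_s1 (p) : R (s1 p) = R p := by
  have key : ∀ p u v, R p u v → R (s1 p) u v := by
    rintro p u v ⟨q, hq, hl, hh⟩
    exact ⟨s1 q, mem_moves_s1 hq, by rw [lo_s1, hl], by rw [hi_s1, hh]⟩
  have inv : s1 (s1 p) = p := rfl
  funext u v
  refine propext ⟨fun h => ?_, fun h => key p u v h⟩
  have := key (s1 p) u v h
  rwa [inv] at this

theorem R_s2 (p) : R (s2 p) = R p := by
  have key : ∀ p u v, R p u v → R (s2 p) u v := by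
    rintro p u v ⟨q, hq, hl, hh⟩
    exact ⟨s2 q, mem_moves_s2 hq, by rw [lo_s2, hl], by rw [hi_s2, hh]⟩
  have inv : s2 (s2 p) = p := rfl
  funext u v
  refine propext ⟨fun h => ?_, fun h => key p u v h⟩
  have := key (s2 p) u v h
  rwa [inv] at this

/-- The reachable gap pairs from `(x, y)`. -/
def RR (x y u v : ℕ) : Prop :=
  (∃ k, 1 ≤ k ∧ 2 * k ≤ x ∧ u = x - 2 * k ∧ v = y + k) ∨
  (∃ k, 1 ≤ k ∧ 2 * k ≤ y ∧ u = x + k ∧ v = y - 2 * k) ∨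
  (∃ k, 1 ≤ k ∧ k ≤ x ∧ k ≤ y ∧ u = x - k ∧ v = y - k) ∨
  (∃ k, 1 ≤ k ∧ x + 2 * k ≤ y ∧ u = k ∧ v = y - x - 2 * k) ∨
  (∃ k, 1 ≤ k ∧ y + 2 * k ≤ x ∧ u = x - y - 2 * k ∧ v = k)

set_option maxHeartbeats 4000000 in
theorem R_sorted {a b c : ℕ} (h : a ≤ b) (h' : b ≤ c) (u v : ℕ) :
    R (a, b, c) u v ↔ RR (b - a) (c - b) u v := by
  constructor
  · rintro ⟨q, hq, rfl, rfl⟩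
    simp only [moves, Finset.mem_union, Finset.mem_image, Finset.mem_Icc] at hq
    rcases hq with ((((⟨k, ⟨hk1, hk2⟩, rfl⟩ | ⟨k, ⟨hk1, hk2⟩, rfl⟩) | ⟨k, ⟨hk1, hk2⟩, rfl⟩) |
      ⟨k, ⟨hk1, hk2⟩, rfl⟩) | ⟨k, ⟨hk1, hk2⟩, rfl⟩) | ⟨k, ⟨hk1, hk2⟩, rfl⟩
    · refine Or.inl ⟨k, hk1, by omega, ?_, ?_⟩ <;> simp only [lo, hi] <;> omega
    · omega
    · by_cases h1 : k ≤ b - a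
      · by_cases h2 : k ≤ c - b
        · refine Or.inr (Or.inr (Or.inl ⟨k, hk1, by omega, by omega, ?_, ?_⟩)) <;>
            simp only [lo, hi] <;> omega
        · refine Or.inr (Or.inr (Or.inr (Or.inr ⟨k - (c - b), by omega, by omega, ?_, ?_⟩))) <;>
            simp only [lo, hi] <;> omega
      · refine Or.inr (Or.inr (Or.inr (Or.inl ⟨k - (b - a), by omega, by omega, ?_, ?_⟩))) <;>
            simp only [lo, hi] <;> omega
    · omega
    · refine Or.inr (Or.inl ⟨k, hk1, by omega, ?_, ?_⟩) <;> simp only [lo, hi] <;> omega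
    · omega
  · have m1 : ∀ k, 1 ≤ k → k ≤ (b - a) / 2 → (a + k, b - k, c) ∈ moves (a, b, c) := by
      intro k h1 h2
      simp only [moves, Finset.mem_union, Finset.mem_image, Finset.mem_Icc]
      exact Or.inl (Or.inl (Or.inl (Or.inl (Or.inl ⟨k, ⟨h1, h2⟩, rfl⟩))))
    have m2 : ∀ k, 1 ≤ k → k ≤ (c - a) / 2 → (a + k, b, c - k) ∈ moves (a, b, c) := by
      intro k h1 h2
      simp only [moves, Finset.mem_union, Finset.mem_image, Finset.mem_Icc]
      exact Or.inl (Or.inl (Or.inl (Or.inr ⟨k, ⟨h1, h2⟩, rfl⟩)))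
    have m3 : ∀ k, 1 ≤ k → k ≤ (c - b) / 2 → (a, b + k, c - k) ∈ moves (a, b, c) := by
      intro k h1 h2
      simp only [moves, Finset.mem_union, Finset.mem_image, Finset.mem_Icc]
      exact Or.inl (Or.inr ⟨k, ⟨h1, h2⟩, rfl⟩)
    rintro (⟨k, h1, h2, rfl, rfl⟩ | ⟨k, h1, h2, rfl, rfl⟩ | ⟨k, h1, h2, h3, rfl, rfl⟩ |
      ⟨k, h1, h2, rfl, rfl⟩ | ⟨k, h1, h2, rfl, rfl⟩)
    · refine ⟨_, m1 k h1 (by omega), ?_, ?_⟩ <;> simp only [lo, hi] <;> omega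
    · refine ⟨_, m3 k h1 (by omega), ?_, ?_⟩ <;> simp only [lo, hi] <;> omega
    · refine ⟨_, m2 k h1 (by omega), ?_, ?_⟩ <;> simp only [lo, hi] <;> omega
    · refine ⟨_, m2 (b - a + u) (by omega) (by omega), ?_, ?_⟩ <;> simp only [lo, hi] <;> omega
    · refine ⟨_, m2 (c - b + v) (by omega) (by omega), ?_, ?_⟩ <;> simp only [lo, hi] <;> omega

theorem R_iff (p : ℕ × ℕ × ℕ) (u v : ℕ) : R p u v ↔ RR (lo p) (hi p) u v := by
  have key : ∀ a b c : ℕ, a ≤ b → b ≤ c → (R (a, b, c) u v ↔ RR (lo (a, b, c)) (hi (a, b, c)) u v) := by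
    intro a b c h h'
    rw [lo_sorted h h', hi_sorted h h', R_sorted h h']
  have k1 : ∀ p, (R (s1 p) u v ↔ RR (lo (s1 p)) (hi (s1 p)) u v) →
      (R p u v ↔ RR (lo p) (hi p) u v) := by
    intro p h; rwa [R_s1, lo_s1, hi_s1] at h
  have k2 : ∀ p, (R (s2 p) u v ↔ RR (lo (s2 p)) (hi (s2 p)) u v) →
      (R p u v ↔ RR (lo p) (hi p) u v) := by
    intro p h; rwa [R_s2, lo_s2, hi_s2] at h
  obtain ⟨a, b, c⟩ := p
  rcases le_total a b with h1 | h1 <;> rcases le_total b c with h2 | h2 <;>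
    rcases le_total a c with h3 | h3
  · exact key _ _ _ h1 h2
  · exact key _ _ _ h1 h2
  · exact k2 _ (key _ _ _ h3 h2)
  · exact k2 _ (k1 _ (key _ _ _ h3 h1))
  · exact k1 _ (key _ _ _ h1 h3)
  · exact k1 _ (k2 _ (key _ _ _ h2 h3))
  · exact k2 _ (k1 _ (k2 _ (key _ _ _ h2 h1)))
  · exact k2 _ (k1 _ (k2 _ (key _ _ _ h2 h1)))

theorem RR_symm {x y u v : ℕ} (h : RR x y u v) : RR y x v u := by
  rcases h with ⟨k, h1, h2, h3, h4⟩ | ⟨k, h1, h2, h3, h4⟩ | ⟨k, h1, h2, h3, h4, h5⟩ |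
    ⟨k, h1, h2, h3, h4⟩ | ⟨k, h1, h2, h3, h4⟩
  · exact Or.inr (Or.inl ⟨k, h1, h2, h4, h3⟩)
  · exact Or.inl ⟨k, h1, h2, h4, h3⟩
  · exact Or.inr (Or.inr (Or.inl ⟨k, h1, h3, h2, h5, h4⟩))
  · exact Or.inr (Or.inr (Or.inr (Or.inr ⟨k, h1, h2, h4, h3⟩)))
  · exact Or.inr (Or.inr (Or.inr (Or.inl ⟨k, h1, h2, h4, h3⟩)))

theorem D0_symm {x y : ℕ} (h : D0 x y) : D0 y x := Or.symm h

theorem D1_symm {x y : ℕ} (h : D1 x y) : D1 y x := by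
  unfold D1 at *; omega

theorem D0_D1 {x y : ℕ} (h : D0 x y) (h' : D1 x y) : False := by
  rcases h with ⟨rfl, h⟩ | ⟨rfl, h⟩
  · have : ¬ y % 4 = 2 := fun hh => not_E_two hh h
    unfold D1 at h'; omega
  · have : ¬ x % 4 = 2 := fun hh => not_E_two hh h
    unfold D1 at h'; omega

theorem D0_stay {x y u v : ℕ} (h : D0 x y) (hr : RR x y u v) (h' : D0 u v) : False := by
  have key : ∀ y u v : ℕ, E y → RR 0 y u v → D0 u v → False := by
    intro y u v hy hr h'
    have h1 : 1 ≤ u ∧ y = 2 * u + v := by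
      rcases hr with ⟨k, h⟩ | ⟨k, h⟩ | ⟨k, h⟩ | ⟨k, h⟩ | ⟨k, h⟩ <;> omega
    obtain ⟨h1, rfl⟩ := h1
    rcases h' with ⟨h2, _⟩ | ⟨rfl, h2⟩
    · omega
    · exact (E_two_mul h1).1 hy h2
  rcases h with ⟨rfl, h⟩ | ⟨rfl, h⟩
  · exact key _ _ _ h hr h'
  · exact key _ _ _ h (RR_symm hr) (D0_symm h')

set_option maxHeartbeats 4000000 in
theorem D1_stay {x y u v : ℕ} (h : D1 x y) (hr : RR x y u v) (h' : D1 u v) : False := by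
  unfold D1 at *
  rcases hr with ⟨k, hr⟩ | ⟨k, hr⟩ | ⟨k, hr⟩ | ⟨k, hr⟩ | ⟨k, hr⟩ <;>
  rcases h with h | h | h | h | h <;> omega

theorem D0_move {x y : ℕ} (h : ¬ D0 x y) : ∃ u v, RR x y u v ∧ D0 u v := by
  have key : ∀ x y : ℕ, x ≤ y → ¬ D0 x y → ∃ u v, RR x y u v ∧ D0 u v := by
    intro x y hxy h
    by_cases he : E (y - x)
    · have hx : x ≠ 0 := by
        rintro rfl
        exact h (Or.inl ⟨rfl, he⟩)
      exact ⟨0, y - x, Or.inr (Or.inr (Or.inl ⟨x, by omega, by omega, by omega, by omega, rfl⟩)),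
        Or.inl ⟨rfl, he⟩⟩
    · have h0 : y - x ≠ 0 := fun h0 => he (h0 ▸ E_zero)
      have h2 : ¬ (y - x) % 2 = 1 := fun h0 => he (E_odd h0)
      obtain ⟨k, hk⟩ : ∃ k, y - x = 2 * k := ⟨(y - x) / 2, by omega⟩
      rw [hk, E_two_mul (by omega), not_not] at he
      exact ⟨k, 0, Or.inr (Or.inr (Or.inr (Or.inl ⟨k, by omega, by omega, rfl, by omega⟩))),
        Or.inr ⟨rfl, he⟩⟩
  rcases le_total x y with hxy | hxy
  · exact key x y hxy h
  · obtain ⟨u, v, h1, h2⟩ := key y x hxy (fun hh => h (D0_symm hh))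
    exact ⟨v, u, RR_symm h1, D0_symm h2⟩

set_option maxHeartbeats 4000000 in
theorem D1_move {x y : ℕ} (h : ¬ D0 x y) (h1 : ¬ D1 x y) : ∃ u v, RR x y u v ∧ D1 u v := by
  have key : ∀ x y : ℕ, x ≤ y → ¬ D0 x y → ¬ D1 x y → ∃ u v, RR x y u v ∧ D1 u v := by
    intro x y hxy h h1
    have c2 : ∀ k, 1 ≤ k → 2 * k ≤ y → D1 (x + k) (y - 2 * k) → ∃ u v, RR x y u v ∧ D1 u v :=
      fun k a b c => ⟨_, _, Or.inr (Or.inl ⟨k, a, b, rfl, rfl⟩), c⟩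
    have c3 : ∀ k, 1 ≤ k → k ≤ x → D1 (x - k) (y - k) → ∃ u v, RR x y u v ∧ D1 u v :=
      fun k a b c => ⟨_, _, Or.inr (Or.inr (Or.inl ⟨k, a, b, by omega, rfl, rfl⟩)), c⟩
    have c4 : ∀ k, 1 ≤ k → x + 2 * k ≤ y → D1 k (y - x - 2 * k) → ∃ u v, RR x y u v ∧ D1 u v :=
      fun k a b c => ⟨_, _, Or.inr (Or.inr (Or.inr (Or.inl ⟨k, a, b, rfl, rfl⟩))), c⟩
    by_cases hx : x = 0
    · subst hx
      have g : ¬ E y := fun hh => h (Or.inl ⟨rfl, hh⟩)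
      have g1 : y ≠ 0 := fun h0 => g (h0 ▸ E_zero)
      have g2 : ¬ y % 2 = 1 := fun h0 => g (E_odd h0)
      have g3 : ¬ y % 8 = 4 := fun h0 => g (E_four h0)
      unfold D1 at h1
      refine c2 (y / 2 - 1) (by omega) (by omega) ?_
      unfold D1; omega
    by_cases hxe : x = y
    · unfold D1 at h1
      refine c3 (x - 1) (by omega) (by omega) ?_
      unfold D1; omega
    unfold D1 at h1
    by_cases e2 : (y - x) % 4 = 2
    · refine c3 x (by omega) (by omega) ?_
      unfold D1; omega
    by_cases e4 : (y - x) % 8 = 4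
    · refine c4 ((y - x) / 2) (by omega) (by omega) ?_
      unfold D1; omega
    by_cases e0 : (y - x) % 8 = 0
    · refine c4 ((y - x) / 2 - 1) (by omega) (by omega) ?_
      unfold D1; omega
    by_cases e3 : (y - x) % 4 = 3
    · by_cases e : y - x = 3
      · refine c4 1 (by omega) (by omega) ?_
        unfold D1; omega
      · refine c4 2 (by omega) (by omega) ?_
        unfold D1; omega
    by_cases x1 : x = 1
    · by_cases y8 : y % 8 = 2
      · refine c2 (y / 2) (by omega) (by omega) ?_
        unfold D1; omega
      · refine c2 (y / 2 - 1) (by omega) (by omega) ?_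
        unfold D1; omega
    · refine c3 (x - 2) (by omega) (by omega) ?_
      unfold D1; omega
  rcases le_total x y with hxy | hxy
  · exact key x y hxy h h1
  · obtain ⟨u, v, h1, h2⟩ := key y x hxy (fun hh => h (D0_symm hh)) (fun hh => h1 (D1_symm hh))
    exact ⟨v, u, RR_symm h1, D1_symm h2⟩

theorem mex_spec (s : Finset ℕ) : mex s ∉ s ∧ ∀ m < mex s, m ∈ s := by
  have hne : {n : ℕ | n ∉ s}.Nonempty := Infinite.exists_notMem_finset s
  refine ⟨Nat.sInf_mem hne, fun m hm => ?_⟩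
  have := Nat.notMem_of_lt_sInf hm
  simpa using this

theorem G_ne {p q : ℕ × ℕ × ℕ} (h : q ∈ moves p) : G p ≠ G q := by
  intro he
  have := (mex_spec ((moves p).attach.image fun q => G q.1)).1
  rw [← G] at this
  apply this
  rw [he]
  exact Finset.mem_image.2 ⟨⟨q, h⟩, Finset.mem_attach _ _, rfl⟩

theorem G_lt {p : ℕ × ℕ × ℕ} {m : ℕ} (h : m < G p) : ∃ q ∈ moves p, G q = m := by
  have := (mex_spec ((moves p).attach.image fun q => G q.1)).2 m
  rw [← G] at this
  obtain ⟨q, _, hq⟩ := Finset.mem_image.1 (this h)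
  exact ⟨q.1, q.2, hq⟩

theorem main_char (N : ℕ) : ∀ p, measure3 p = N →
    (G p = 0 ↔ D0 (lo p) (hi p)) ∧ (G p = 1 ↔ D1 (lo p) (hi p)) := by
  induction N using Nat.strong_induction_on with
  | _ N ih =>
    rintro p rfl
    have ih' : ∀ q ∈ moves p,
        (G q = 0 ↔ D0 (lo q) (hi q)) ∧ (G q = 1 ↔ D1 (lo q) (hi q)) :=
      fun q hq => ih _ (measure3_lt_of_mem_moves hq) q rfl
    have rr : ∀ q ∈ moves p, RR (lo p) (hi p) (lo q) (hi q) :=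
      fun q hq => (R_iff p _ _).1 ⟨q, hq, rfl, rfl⟩
    have z : G p = 0 ↔ D0 (lo p) (hi p) := by
      constructor
      · intro h
        by_contra hn
        obtain ⟨u, v, hr, hd⟩ := D0_move hn
        obtain ⟨q, hq, rfl, rfl⟩ := (R_iff p _ _).2 hr
        exact G_ne hq (h.trans ((ih' q hq).1.2 hd).symm)
      · intro h
        by_contra hn
        obtain ⟨q, hq, h0⟩ := G_lt (Nat.pos_of_ne_zero hn)
        exact D0_stay h (rr q hq) ((ih' q hq).1.1 h0)
    refine ⟨z, ?_, ?_⟩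
    · intro h
      by_contra hn
      have hn0 : ¬ D0 (lo p) (hi p) := fun h0 => by
        have := z.2 h0
        omega
      obtain ⟨u, v, hr, hd⟩ := D1_move hn0 hn
      obtain ⟨q, hq, rfl, rfl⟩ := (R_iff p _ _).2 hr
      exact G_ne hq (h.trans ((ih' q hq).2.2 hd).symm)
    · intro h
      by_contra hn
      have hn0 : G p ≠ 0 := fun h0 => D0_D1 (z.1 h0) h
      obtain ⟨q, hq, h0⟩ := G_lt (show 1 < G p by omega)
      exact D1_stay h (rr q hq) ((ih' q hq).2.1 h0)

/-- For `n ≥ 2`, `G(0,2,n) = 1` iff `n = 2`, or `n ≥ 5` and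
`n ≡ 1 (mod 4)`. -/
theorem grundy_one_third_row (n : ℕ) (hn : 2 ≤ n) :
    G (0, 2, n) = 1 ↔ n = 2 ∨ (5 ≤ n ∧ n % 4 = 1) := by
  rw [(main_char _ (0, 2, n) rfl).2, lo_sorted (by omega) hn, hi_sorted (by omega) hn]
  unfold D1
  omega

end SharingNim
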